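/- arXiv:2403.16515 — 4 statements merged into one kernel-verified Lean document; each statement's English description precedes it below -/
import Mathlib

section
/- Let r₀ > 0 and let ψ : [r₀, ∞) → ℝ be smooth with r − μψ(r) > 0 and μr + ψ(r) > 0 for all r ≥ r₀, satisfying the minimal-surface ODE ψ''(r)/(1 + ψ'(r)²) + (p − 1)(μ + ψ'(r))/(r − μψ(r)) − (q − 1)(1 − μψ'(r))/(μr + ψ(r)) = 0 for all r ≥ r₀, and suppose lim_{r→∞} ψ(r)/r^α = 1 and lim_{r→∞} ψ'(r)/r^{α−1} = α. Then for every integer m ≥ 0 there exists a constant C > 0 such that |ψ^{(m)}(r) − α(α − 1)(α − 2)⋯(α − m + 1) r^{α−m}| ≤ C r^{α̃−m} for all r ≥ r₀ (for m = 0 the empty product equals 1, i.e. |ψ(r) − r^α| ≤ C r^{α̃}). -/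
open Set Filter

/-- `SymbolBound r₀ k β g` says that `g` is `k` times differentiable on `[r₀, ∞)` and that its
`j`-th derivative is `O(r ^ (β - j))` there, for every `j ≤ k`. -/
def SymbolBound (r₀ : ℝ) : ℕ → ℝ → (ℝ → ℝ) → Prop
  | 0, β, g => ∃ C, ∀ r ≥ r₀, |g r| ≤ C * r ^ β
  | k + 1, β, g => (∃ C, ∀ r ≥ r₀, |g r| ≤ C * r ^ β) ∧
      ∃ g' : ℝ → ℝ, (∀ r ≥ r₀, HasDerivWithinAt g (g' r) (Ici r₀) r) ∧
        SymbolBound r₀ k (β - 1) g'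

namespace SymbolBound

variable {r₀ : ℝ} {k : ℕ} {β γ : ℝ} {g h : ℝ → ℝ}

theorem bound (hg : SymbolBound r₀ k β g) : ∃ C, ∀ r ≥ r₀, |g r| ≤ C * r ^ β := by
  cases k with
  | zero => exact hg
  | succ k => exact hg.1

theorem bound_pos (hr₀ : 0 < r₀) (hg : SymbolBound r₀ k β g) :
    ∃ C, 0 < C ∧ ∀ r ≥ r₀, |g r| ≤ C * r ^ β := by
  obtain ⟨C, hC⟩ := hg.bound
  refine ⟨max C 1, by positivity, fun r hr => (hC r hr).trans ?_⟩
  have : 0 ≤ r ^ β := Real.rpow_nonneg (hr₀.le.trans hr) _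
  gcongr
  exact le_max_left _ _

theorem of_succ (hg : SymbolBound r₀ (k + 1) β g) : SymbolBound r₀ k β g := by
  induction k generalizing β g with
  | zero => exact hg.1
  | succ k ih =>
    obtain ⟨hb, g', hd, hg'⟩ := hg
    exact ⟨hb, g', hd, ih hg'⟩

theorem congr (hg : SymbolBound r₀ k β g) (hgh : ∀ r ≥ r₀, h r = g r) :
    SymbolBound r₀ k β h := by
  have hb : ∃ C, ∀ r ≥ r₀, |h r| ≤ C * r ^ β := by
    obtain ⟨C, hC⟩ := hg.bound
    exact ⟨C, fun r hr => by rw [hgh r hr]; exact hC r hr⟩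
  cases k with
  | zero => exact hb
  | succ k =>
    obtain ⟨-, g', hd, hg'⟩ := hg
    exact ⟨hb, g', fun r hr => (hd r hr).congr hgh (hgh r hr), hg'⟩

theorem mono (hr₀ : 0 < r₀) (hg : SymbolBound r₀ k β g) (hβγ : β ≤ γ) :
    SymbolBound r₀ k γ g := by
  have key : ∀ {β γ : ℝ} {g : ℝ → ℝ}, β ≤ γ → (∃ C, 0 < C ∧ ∀ r ≥ r₀, |g r| ≤ C * r ^ β) →
      ∃ C, ∀ r ≥ r₀, |g r| ≤ C * r ^ γ := by
    rintro β γ g hβγ ⟨C, hC0, hC⟩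
    refine ⟨C * r₀ ^ (β - γ), fun r hr => (hC r hr).trans ?_⟩
    have hr0 : 0 < r := hr₀.trans_le hr
    have h1 : r ^ β = r ^ (β - γ) * r ^ γ := by
      rw [← Real.rpow_add hr0]; congr 1; ring
    have h2 : r ^ (β - γ) ≤ r₀ ^ (β - γ) :=
      Real.rpow_le_rpow_of_nonpos hr₀ hr (by linarith)
    rw [h1, ← mul_assoc]
    gcongr
  induction k generalizing β γ g with
  | zero => exact key hβγ (hg.bound_pos hr₀)
  | succ k ih =>
    obtain ⟨g', hd, hg'⟩ := hg.2
    exact ⟨key hβγ (hg.bound_pos hr₀), g', hd, ih hg' (by linarith)⟩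

theorem bound_add (hg : SymbolBound r₀ k β g) (hh : SymbolBound r₀ k β h) :
    ∃ C, ∀ r ≥ r₀, |g r + h r| ≤ C * r ^ β := by
  obtain ⟨C, hC⟩ := hg.bound
  obtain ⟨E, hE⟩ := hh.bound
  refine ⟨C + E, fun r hr => (abs_add_le _ _).trans ?_⟩
  rw [add_mul]
  exact add_le_add (hC r hr) (hE r hr)

theorem add (hg : SymbolBound r₀ k β g) (hh : SymbolBound r₀ k β h) :
    SymbolBound r₀ k β (fun r => g r + h r) := by
  induction k generalizing β g h with
  | zero => exact bound_add hg hh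
  | succ k ih =>
    have hb := bound_add hg hh
    obtain ⟨-, g', hd, hg'⟩ := hg
    obtain ⟨-, h', he, hh'⟩ := hh
    exact ⟨hb, _, fun r hr => (hd r hr).add (he r hr), ih hg' hh'⟩

theorem bound_mul (hr₀ : 0 < r₀) (hg : SymbolBound r₀ k β g) (hh : SymbolBound r₀ k γ h) :
    ∃ C, ∀ r ≥ r₀, |g r * h r| ≤ C * r ^ (β + γ) := by
  obtain ⟨C, hC⟩ := hg.bound
  obtain ⟨E, hE⟩ := hh.bound
  refine ⟨C * E, fun r hr => ?_⟩
  rw [Real.rpow_add (hr₀.trans_le hr), abs_mul, mul_mul_mul_comm]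
  exact mul_le_mul (hC r hr) (hE r hr) (abs_nonneg _) ((abs_nonneg _).trans (hC r hr))

theorem mul (hr₀ : 0 < r₀) (hg : SymbolBound r₀ k β g) (hh : SymbolBound r₀ k γ h) :
    SymbolBound r₀ k (β + γ) (fun r => g r * h r) := by
  induction k generalizing β γ g h with
  | zero => exact bound_mul hr₀ hg hh
  | succ k ih =>
    have hg0 := hg.of_succ
    have hh0 := hh.of_succ
    refine ⟨bound_mul hr₀ hg hh, ?_⟩
    obtain ⟨-, g', hd, hg'⟩ := hg
    obtain ⟨-, h', he, hh'⟩ := hh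
    refine ⟨_, fun r hr => (hd r hr).mul (he r hr), ?_⟩
    exact ((ih hg' hh0).mono hr₀ (by linarith)).add ((ih hg0 hh').mono hr₀ (by linarith))

theorem const_mul_rpow (hr₀ : 0 < r₀) (c s : ℝ) :
    SymbolBound r₀ k s (fun r => c * r ^ s) := by
  have key : ∀ c s : ℝ, ∃ C, ∀ r ≥ r₀, |c * r ^ s| ≤ C * r ^ s := fun c s =>
    ⟨|c|, fun r hr => by
      rw [abs_mul, abs_of_nonneg (Real.rpow_nonneg (hr₀.le.trans hr) s)]⟩
  induction k generalizing c s with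
  | zero => exact key c s
  | succ k ih =>
    refine ⟨key c s, fun r => c * s * r ^ (s - 1), fun r hr => ?_, ih _ _⟩
    simp only [mul_assoc]
    exact ((Real.hasDerivAt_rpow_const
      (Or.inl (hr₀.trans_le hr).ne')).const_mul c).hasDerivWithinAt

theorem const (hr₀ : 0 < r₀) (c : ℝ) : SymbolBound r₀ k 0 (fun _ => c) :=
  (const_mul_rpow hr₀ c 0).congr fun r _ => by simp

theorem npow (hr₀ : 0 < r₀) (m : ℕ) : SymbolBound r₀ k m (fun r => r ^ m) :=
  (const_mul_rpow hr₀ 1 m).congr fun r _ => by simp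

theorem id (hr₀ : 0 < r₀) : SymbolBound r₀ k 1 (fun r => r) :=
  (const_mul_rpow hr₀ 1 1).congr fun r _ => by simp

theorem npow_inv (hr₀ : 0 < r₀) (m : ℕ) : SymbolBound r₀ k (-m) (fun r => (r ^ m)⁻¹) :=
  (const_mul_rpow hr₀ 1 (-m)).congr fun r hr => by
    rw [Real.rpow_neg (hr₀.le.trans hr)]; simp

theorem const_mul (hr₀ : 0 < r₀) (hg : SymbolBound r₀ k β g) (c : ℝ) :
    SymbolBound r₀ k β (fun r => c * g r) :=
  ((const hr₀ c).mul hr₀ hg).mono hr₀ (by simp)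

theorem sub (hr₀ : 0 < r₀) (hg : SymbolBound r₀ k β g) (hh : SymbolBound r₀ k β h) :
    SymbolBound r₀ k β (fun r => g r - h r) :=
  (hg.add (hh.const_mul hr₀ (-1))).congr fun r _ => by ring

theorem inv (hr₀ : 0 < r₀) (hg : SymbolBound r₀ k β g) (hne : ∀ r ≥ r₀, g r ≠ 0)
    (hinv : ∃ C, ∀ r ≥ r₀, |(g r)⁻¹| ≤ C * r ^ (-β)) :
    SymbolBound r₀ k (-β) (fun r => (g r)⁻¹) := by
  induction k with
  | zero => exact hinv
  | succ k ih =>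
    have hi := ih hg.of_succ
    obtain ⟨-, g', hd, hg'⟩ := hg
    refine ⟨hinv, _, fun r hr => (hd r hr).inv (hne r hr), ?_⟩
    refine ((((hg'.mul hr₀ hi).mul hr₀ hi).const_mul hr₀ (-1)).mono hr₀ (by linarith)).congr
      fun r hr => ?_
    have := hne r hr
    field_simp

/-- A family of successive derivatives inherits the bounds encoded in its first member. -/
theorem bound_iterate {F : ℕ → ℝ → ℝ}
    (hF : ∀ m, ∀ r ≥ r₀, HasDerivWithinAt (F m) (F (m + 1) r) (Ici r₀) r) {j : ℕ}
    (hS : SymbolBound r₀ k β (F j)) : SymbolBound r₀ 0 (β - k) (F (j + k)) := by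
  induction k generalizing β j with
  | zero => simpa using hS
  | succ k ih =>
    obtain ⟨-, g', hd, hg'⟩ := hS
    have h1 : SymbolBound r₀ k (β - 1) (F (j + 1)) := hg'.congr fun r hr =>
      (uniqueDiffOn_Ici r₀ r hr).eq_deriv _ (hF j r hr) (hd r hr)
    have h2 := ih h1
    have e1 : β - 1 - (k : ℝ) = β - ((k + 1 : ℕ) : ℝ) := by push_cast; ring
    have e2 : j + 1 + k = j + (k + 1) := by ring
    rwa [e1, e2] at h2

end SymbolBound

theorem exists_bound_of_tendsto_div_rpow {r₀ β L : ℝ} {g : ℝ → ℝ} (hr₀ : 0 < r₀)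
    (hg : ContinuousOn g (Ici r₀)) (hL : Tendsto (fun r => g r / r ^ β) atTop (nhds L)) :
    ∃ C, ∀ r ≥ r₀, |g r| ≤ C * r ^ β := by
  have hpos : ∀ r ≥ r₀, 0 < r ^ β := fun r hr => Real.rpow_pos_of_pos (hr₀.trans_le hr) _
  have hcont : ContinuousOn (fun r => g r / r ^ β) (Ici r₀) :=
    hg.div (fun r hr => (Real.continuousAt_rpow_const r β
      (Or.inl (hr₀.trans_le hr).ne')).continuousWithinAt) fun r hr => (hpos r hr).ne'
  obtain ⟨R, hR⟩ := eventually_atTop.1 (hL.abs.eventually_lt_const (lt_add_one |L|))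
  obtain ⟨K, hK⟩ := isCompact_Icc.exists_bound_of_continuousOn
    (hcont.mono (Icc_subset_Ici_self : Icc r₀ R ⊆ Ici r₀))
  refine ⟨max (|L| + 1) K, fun r hr => ?_⟩
  rw [← div_le_iff₀ (hpos r hr)]
  have e : |g r| / r ^ β = |g r / r ^ β| := by rw [abs_div, abs_of_pos (hpos r hr)]
  rw [e]
  rcases le_total R r with h | h
  · exact (hR r h).le.trans (le_max_left _ _)
  · exact (hK r ⟨hr, h⟩).trans (le_max_right _ _)

theorem antitoneOn_sub_of_deriv_bound {r₀ s C : ℝ} {W W' : ℝ → ℝ} (hr₀ : 0 < r₀) (hs : s ≠ 0)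
    (hW : ∀ r ≥ r₀, HasDerivWithinAt W (W' r) (Ici r₀) r)
    (hb : ∀ r ≥ r₀, |W' r| ≤ C * r ^ (s - 1)) :
    AntitoneOn (fun r => W r - C / s * r ^ s) (Ici r₀) := by
  have hd : ∀ r ≥ r₀, HasDerivWithinAt (fun r => W r - C / s * r ^ s)
      (W' r - C / s * (s * r ^ (s - 1))) (Ici r₀) r := fun r hr =>
    (hW r hr).sub ((Real.hasDerivAt_rpow_const
      (Or.inl (hr₀.trans_le hr).ne')).const_mul _).hasDerivWithinAt
  refine antitoneOn_of_hasDerivWithinAt_nonpos (convex_Ici r₀)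
    (fun r hr => (hd r hr).continuousWithinAt)
    (fun r hr => (hd r (interior_subset hr)).mono interior_subset) fun r hr => ?_
  have h1 := (abs_le.1 (hb r (interior_subset hr))).2
  have h2 : C / s * (s * r ^ (s - 1)) = C * r ^ (s - 1) := by field_simp
  linarith

theorem abs_sub_limit_le_of_deriv_bound {r₀ s C L : ℝ} {W W' : ℝ → ℝ} (hr₀ : 0 < r₀)
    (hs : s < 0) (hW : ∀ r ≥ r₀, HasDerivWithinAt W (W' r) (Ici r₀) r)
    (hb : ∀ r ≥ r₀, |W' r| ≤ C * r ^ (s - 1)) (hL : Tendsto W atTop (nhds L)) :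
    ∀ r ≥ r₀, |W r - L| ≤ -(C / s) * r ^ s := by
  have key : ∀ {W W' : ℝ → ℝ} {L : ℝ}, (∀ r ≥ r₀, HasDerivWithinAt W (W' r) (Ici r₀) r) →
      (∀ r ≥ r₀, |W' r| ≤ C * r ^ (s - 1)) → Tendsto W atTop (nhds L) →
      ∀ r ≥ r₀, L ≤ W r - C / s * r ^ s := by
    intro W W' L hW hb hL r hr
    have hpow : Tendsto (fun r : ℝ => r ^ s) atTop (nhds 0) := by
      simpa using tendsto_rpow_neg_atTop (neg_pos.2 hs)
    have hlim : Tendsto (fun r => W r - C / s * r ^ s) atTop (nhds L) := by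
      simpa using hL.sub (hpow.const_mul (C / s))
    refine le_of_tendsto hlim ?_
    filter_upwards [eventually_ge_atTop r] with x hx
    exact antitoneOn_sub_of_deriv_bound hr₀ hs.ne hW hb hr (hr.le.trans hx) hx
  intro r hr
  have h1 := key hW hb hL r hr
  have h2 := key (W := fun r => -W r) (W' := fun r => -W' r) (fun r hr => (hW r hr).neg)
    (fun r hr => by rw [abs_neg]; exact hb r hr) hL.neg r hr
  rw [abs_le]
  constructor <;> linarith

theorem abs_le_of_deriv_bound {r₀ s C : ℝ} {W W' : ℝ → ℝ} (hr₀ : 0 < r₀)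
    (hs : s ≠ 0) (hW : ∀ r ≥ r₀, HasDerivWithinAt W (W' r) (Ici r₀) r)
    (hb : ∀ r ≥ r₀, |W' r| ≤ C * r ^ (s - 1)) :
    ∀ r ≥ r₀, |W r| ≤ (|W r₀| + |C / s * r₀ ^ s|) + |C / s| * r ^ s := by
  have key : ∀ {W W' : ℝ → ℝ}, (∀ r ≥ r₀, HasDerivWithinAt W (W' r) (Ici r₀) r) →
      (∀ r ≥ r₀, |W' r| ≤ C * r ^ (s - 1)) →
      ∀ r ≥ r₀, W r ≤ (|W r₀| + |C / s * r₀ ^ s|) + |C / s| * r ^ s := by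
    intro W W' hW hb r hr
    have h := antitoneOn_sub_of_deriv_bound hr₀ hs hW hb self_mem_Ici hr hr
    have h1 := le_abs_self (W r₀)
    have h2 := neg_abs_le (C / s * r₀ ^ s)
    have h3 : C / s * r ^ s ≤ |C / s| * r ^ s :=
      mul_le_mul_of_nonneg_right (le_abs_self _) (Real.rpow_nonneg (hr₀.le.trans hr) _)
    simp only at h
    linarith
  intro r hr
  have h1 := key hW hb r hr
  have h2 := key (W := fun r => -W r) (W' := fun r => -W' r) (fun r hr => (hW r hr).neg)
    (fun r hr => by rw [abs_neg]; exact hb r hr) r hr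
  rw [abs_neg] at h2
  rw [abs_le]
  constructor <;> linarith

/-- The part of the minimal-surface equation that is at least quadratic in `(ψ, y)`, where `y`
stands for `ψ'`. -/
noncomputable def quadraticRemainder (N μ : ℝ) (ψ y : ℝ → ℝ) (r : ℝ) : ℝ :=
  N * (((r - μ * ψ r) * (μ * r + ψ r))⁻¹ * ((r ^ 2)⁻¹ *
    ((ψ r + r * y r) * ((1 - μ ^ 2) * (r * ψ r) - μ * (ψ r * ψ r))
      - μ * (y r * y r * (r ^ 2 * (ψ r + r * y r)))
      - (1 - μ ^ 2) * ((1 + y r * y r) * (r ^ 2 * (y r * ψ r))))))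

theorem eq_quadraticRemainder_sub_of_ode {a b μ r z : ℝ} {ψ y : ℝ → ℝ} (hr : 0 < r)
    (hb : b = a * μ ^ 2) (h₁ : 0 < r - μ * ψ r) (h₂ : 0 < μ * r + ψ r)
    (h : z / (1 + y r ^ 2) + a * (μ + y r) / (r - μ * ψ r)
      - b * (1 - μ * y r) / (μ * r + ψ r) = 0) :
    z = quadraticRemainder (a + b) μ ψ y r - (a + b) * ((r ^ 2)⁻¹ * (ψ r + r * y r)) := by
  unfold quadraticRemainder
  generalize ψ r = u at *
  generalize y r = w at *
  have hw : 0 < 1 + w ^ 2 := by positivity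
  have hz : z = (1 + w ^ 2) * (b * (1 - μ * w) / (μ * r + u) - a * (μ + w) / (r - μ * u)) := by
    have : z / (1 + w ^ 2) = b * (1 - μ * w) / (μ * r + u) - a * (μ + w) / (r - μ * u) := by
      linarith
    rw [div_eq_iff hw.ne'] at this
    linarith
  rw [hz]
  have := h₁.ne'
  have := h₂.ne'
  subst hb
  field_simp
  ring

theorem SymbolBound.quadraticRemainder {r₀ α μ N : ℝ} {k : ℕ} {ψ y : ℝ → ℝ} (hr₀ : 0 < r₀)
    (hα : α ≤ 1) (hψ : SymbolBound r₀ k α ψ) (hy : SymbolBound r₀ k (α - 1) y)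
    (h₁ : ∀ r ≥ r₀, 0 < r - μ * ψ r) (h₂ : ∀ r ≥ r₀, 0 < μ * r + ψ r)
    (hinv : ∃ C, ∀ r ≥ r₀, |((r - μ * ψ r) * (μ * r + ψ r))⁻¹| ≤ C * r ^ (-2 : ℝ)) :
    SymbolBound r₀ k (2 * α - 3) (quadraticRemainder N μ ψ y) := by
  have hid : SymbolBound r₀ k 1 (fun r => r) := SymbolBound.id hr₀
  have hT : SymbolBound r₀ k α (fun r => ψ r + r * y r) :=
    hψ.add ((hid.mul hr₀ hy).mono hr₀ (by linarith))
  have hsq : SymbolBound r₀ k 2 (fun r => r ^ 2) := by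
    simpa using SymbolBound.npow (k := k) hr₀ 2
  have hsq' : SymbolBound r₀ k (-2) (fun r => (r ^ 2)⁻¹) := by
    simpa using SymbolBound.npow_inv (k := k) hr₀ 2
  have hP : SymbolBound r₀ k 1 (fun r => r - μ * ψ r) :=
    hid.sub hr₀ ((hψ.const_mul hr₀ μ).mono hr₀ hα)
  have hQ : SymbolBound r₀ k 1 (fun r => μ * r + ψ r) :=
    (hid.const_mul hr₀ μ).add (hψ.mono hr₀ hα)
  have hPQ : SymbolBound r₀ k 2 (fun r => (r - μ * ψ r) * (μ * r + ψ r)) :=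
    (hP.mul hr₀ hQ).mono hr₀ (by norm_num)
  have hPQ' := hPQ.inv hr₀ (fun r hr => (mul_pos (h₁ r hr) (h₂ r hr)).ne') hinv
  have hA : SymbolBound r₀ k (2 * α + 1)
      (fun r => (ψ r + r * y r) * ((1 - μ ^ 2) * (r * ψ r) - μ * (ψ r * ψ r))) :=
    (hT.mul hr₀ (((hid.mul hr₀ hψ).const_mul hr₀ (1 - μ ^ 2)).sub hr₀
      (((hψ.mul hr₀ hψ).const_mul hr₀ μ).mono hr₀ (by linarith)))).mono hr₀ (by linarith)
  have hB : SymbolBound r₀ k (2 * α + 1)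
      (fun r => μ * (y r * y r * (r ^ 2 * (ψ r + r * y r)))) :=
    (((hy.mul hr₀ hy).mul hr₀ (hsq.mul hr₀ hT)).const_mul hr₀ μ).mono hr₀ (by linarith)
  have hE : SymbolBound r₀ k (2 * α + 1)
      (fun r => (1 - μ ^ 2) * ((1 + y r * y r) * (r ^ 2 * (y r * ψ r)))) :=
    ((((SymbolBound.const hr₀ 1).add ((hy.mul hr₀ hy).mono hr₀ (by linarith))).mul hr₀
      (hsq.mul hr₀ (hy.mul hr₀ hψ))).const_mul hr₀ _).mono hr₀ (by linarith)
  exact ((hPQ'.mul hr₀ (hsq'.mul hr₀ ((hA.sub hr₀ hB).sub hr₀ hE))).const_mul hr₀ N).mono hr₀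
    (by linarith)

/-- Bootstrap for the equation `u'' = f - N (u + r u') / r ^ 2`: the solution inherits as many
symbol bounds as `f` has, where `f` may itself depend on `u` and `u'`. -/
theorem SymbolBound.bootstrap {r₀ N β : ℝ} {u y z f : ℝ → ℝ} (hr₀ : 0 < r₀)
    (hu : ∀ r ≥ r₀, HasDerivWithinAt u (y r) (Ici r₀) r)
    (hy : ∀ r ≥ r₀, HasDerivWithinAt y (z r) (Ici r₀) r)
    (hz : ∀ r ≥ r₀, z r = f r - N * ((r ^ 2)⁻¹ * (u r + r * y r)))
    (hf : ∀ k, SymbolBound r₀ k β u → SymbolBound r₀ k (β - 1) y →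
      SymbolBound r₀ k (β - 2) f)
    (hu0 : SymbolBound r₀ 0 β u) (hy0 : SymbolBound r₀ 0 (β - 1) y) (k : ℕ) :
    SymbolBound r₀ k β u ∧ SymbolBound r₀ k (β - 1) y := by
  induction k with
  | zero => exact ⟨hu0, hy0⟩
  | succ k ih =>
    obtain ⟨iu, iy⟩ := ih
    refine ⟨⟨hu0, y, hu, iy⟩, hy0, z, hy, ?_⟩
    have hsq' : SymbolBound r₀ k (-2) (fun r => (r ^ 2)⁻¹) := by
      simpa using SymbolBound.npow_inv (k := k) hr₀ 2
    have hT : SymbolBound r₀ k β (fun r => u r + r * y r) :=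
      iu.add (((SymbolBound.id hr₀).mul hr₀ iy).mono hr₀ (by linarith))
    exact ((((hf k iu iy).sub hr₀ (((hsq'.mul hr₀ hT).const_mul hr₀ N).mono hr₀
      (by linarith))).mono hr₀ (by linarith)).congr hz)

theorem exists_inv_mul_bound {r₀ α μ : ℝ} {ψ : ℝ → ℝ} (hr₀ : 0 < r₀) (hα : α < 1) (hμ : 0 < μ)
    (hψ : ContinuousOn ψ (Ici r₀))
    (hlim : Tendsto (fun r => ψ r / r ^ α) atTop (nhds 1))
    (h₁ : ∀ r ≥ r₀, 0 < r - μ * ψ r) (h₂ : ∀ r ≥ r₀, 0 < μ * r + ψ r) :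
    ∃ C, ∀ r ≥ r₀, |((r - μ * ψ r) * (μ * r + ψ r))⁻¹| ≤ C * r ^ (-2 : ℝ) := by
  have hsmall : Tendsto (fun r => ψ r / r) atTop (nhds 0) := by
    have hpow : Tendsto (fun r : ℝ => r ^ (α - 1)) atTop (nhds 0) := by
      simpa using tendsto_rpow_neg_atTop (sub_pos.2 hα)
    refine Tendsto.congr' ?_ (by simpa using hlim.mul hpow)
    filter_upwards [eventually_gt_atTop 0] with r hr
    have := (Real.rpow_pos_of_pos hr α).ne'
    rw [Real.rpow_sub hr, Real.rpow_one]
    field_simp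
  refine exists_bound_of_tendsto_div_rpow (L := ((1 - μ * 0) * (μ + 0))⁻¹) hr₀
    (ContinuousOn.inv₀ (by fun_prop) fun r hr => (mul_pos (h₁ r hr) (h₂ r hr)).ne') ?_
  refine Tendsto.congr' ?_ ((((hsmall.const_mul μ).const_sub 1).mul
    (hsmall.const_add μ)).inv₀ (by simpa using hμ.ne'))
  filter_upwards [eventually_gt_atTop 0, eventually_ge_atTop r₀] with r hr hr'
  have := (h₁ r hr').ne'
  have := (h₂ r hr').ne'
  rw [Real.rpow_neg hr.le]
  norm_cast
  have e1 : 1 - μ * (ψ r / r) = (r - μ * ψ r) / r := by field_simp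
  have e2 : μ + ψ r / r = (μ * r + ψ r) / r := by field_simp
  rw [e1, e2]
  field_simp

/-- Asymptotics of a solution of `r² u'' + N (r u' + u) = O(r ^ (2α - 1))` with `u ∼ r ^ α`, where
`α` and `α'` are the indicial roots. -/
theorem symbolBound_sub_rpow {r₀ N α α' : ℝ} {u y z f : ℝ → ℝ} (hr₀ : 0 < r₀)
    (hα : α < 1) (hsum : α + α' = 1 - N) (hprod : α * α' = N) (hres : 2 * α - 1 ≠ α')
    (hu : ∀ r ≥ r₀, HasDerivWithinAt u (y r) (Ici r₀) r)
    (hy : ∀ r ≥ r₀, HasDerivWithinAt y (z r) (Ici r₀) r)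
    (hz : ∀ r ≥ r₀, z r = f r - N * ((r ^ 2)⁻¹ * (u r + r * y r)))
    (hf : SymbolBound r₀ 0 (2 * α - 3) f)
    (hlim₀ : Tendsto (fun r => u r / r ^ α) atTop (nhds 1))
    (hlim₁ : Tendsto (fun r => y r / r ^ (α - 1)) atTop (nhds α)) :
    SymbolBound r₀ 0 (max (2 * α - 1) α') (fun r => u r - r ^ α) ∧
      SymbolBound r₀ 0 (max (2 * α - 1) α' - 1) (fun r => y r - α * r ^ (α - 1)) := by
  have hpow : ∀ s, ∀ r ≥ r₀, HasDerivWithinAt (fun x : ℝ => x ^ s) (s * r ^ (s - 1)) (Ici r₀) r :=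
    fun s r hr => (Real.hasDerivAt_rpow_const (Or.inl (hr₀.trans_le hr).ne')).hasDerivWithinAt
  -- The first order equation for `r u' - α' u`.
  have hw : SymbolBound r₀ 0 (2 * α - 1)
      (fun r => r * y r - α' * u r - (α - α') * r ^ α) := by
    obtain ⟨C, hC⟩ := hf.bound
    have hW : ∀ r ≥ r₀, HasDerivWithinAt (fun r => r ^ (-α) * (r * y r - α' * u r))
        (r ^ (1 - α) * f r) (Ici r₀) r := by
      intro r hr
      have hr0 : 0 < r := hr₀.trans_le hr
      refine ((hpow (-α) r hr).mul (((hasDerivWithinAt_id r (Ici r₀)).mul (hy r hr)).sub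
        ((hu r hr).const_mul α'))).congr_deriv ?_
      have e1 : r ^ (1 - α) = r * r ^ (-α) := by
        rw [sub_eq_add_neg, Real.rpow_add hr0, Real.rpow_one]
      have e2 : r ^ (-α - 1) = r ^ (-α) / r := by rw [Real.rpow_sub hr0, Real.rpow_one]
      rw [e1, e2, hz r hr]
      simp only [_root_.id, one_mul, Pi.mul_apply, Pi.sub_apply]
      field_simp
      linear_combination u r * hprod - (r * y r) * hsum
    have hL : Tendsto (fun r => r ^ (-α) * (r * y r - α' * u r)) atTop (nhds (α - α' * 1)) := by
      refine Tendsto.congr' ?_ (hlim₁.sub (hlim₀.const_mul α'))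
      filter_upwards [eventually_gt_atTop 0] with r hr
      have := (Real.rpow_pos_of_pos hr α).ne'
      rw [Real.rpow_sub hr, Real.rpow_one, Real.rpow_neg hr.le]
      field_simp
    have hb := abs_sub_limit_le_of_deriv_bound (s := α - 1) (C := C) hr₀ (by linarith) hW
      (fun r hr => by
        have hr0 : 0 < r := hr₀.trans_le hr
        have e : r ^ (α - 1 - 1) = r ^ (1 - α) * r ^ (2 * α - 3) := by
          rw [← Real.rpow_add hr0]; congr 1; ring
        rw [abs_mul, abs_of_pos (Real.rpow_pos_of_pos hr0 _), e, mul_left_comm C]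
        exact mul_le_mul_of_nonneg_left (hC r hr) (Real.rpow_nonneg hr0.le _)) hL
    have hS : SymbolBound r₀ 0 (α - 1)
        (fun r => r ^ (-α) * (r * y r - α' * u r) - (α - α' * 1)) := ⟨_, hb⟩
    refine (((SymbolBound.const_mul_rpow hr₀ 1 α).mul hr₀ hS).mono hr₀ (by linarith)).congr
      fun r hr => ?_
    have hr0 : 0 < r := hr₀.trans_le hr
    have := (Real.rpow_pos_of_pos hr0 α).ne'
    rw [Real.rpow_neg hr0.le]
    field_simp
  have hv : SymbolBound r₀ 0 (max (2 * α - 1) α') (fun r => u r - r ^ α) := by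
    obtain ⟨C, hC⟩ := hw.bound
    have hV : ∀ r ≥ r₀, HasDerivWithinAt (fun r => r ^ (-α') * (u r - r ^ α))
        (r ^ (-α' - 1) * (r * y r - α' * u r - (α - α') * r ^ α)) (Ici r₀) r := by
      intro r hr
      have hr0 : 0 < r := hr₀.trans_le hr
      refine ((hpow (-α') r hr).mul ((hu r hr).sub (hpow α r hr))).congr_deriv ?_
      rw [Real.rpow_sub hr0, Real.rpow_sub hr0, Real.rpow_one]
      simp only [Pi.sub_apply]
      field_simp
      ring
    have hb := abs_le_of_deriv_bound (s := 2 * α - 1 - α') (C := C) hr₀ (sub_ne_zero.2 hres) hV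
      (fun r hr => by
        have hr0 : 0 < r := hr₀.trans_le hr
        have e : r ^ (2 * α - 1 - α' - 1) = r ^ (-α' - 1) * r ^ (2 * α - 1) := by
          rw [← Real.rpow_add hr0]; congr 1; ring
        rw [abs_mul, abs_of_pos (Real.rpow_pos_of_pos hr0 _), e, mul_left_comm C]
        exact mul_le_mul_of_nonneg_left (hC r hr) (Real.rpow_nonneg hr0.le _))
    obtain ⟨E, hE⟩ := ((SymbolBound.const_mul_rpow (k := 0) hr₀
      (|r₀ ^ (-α') * (u r₀ - r₀ ^ α)| + |C / (2 * α - 1 - α') * r₀ ^ (2 * α - 1 - α')|)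
      α').mono hr₀ (le_max_right (2 * α - 1) α')).add
      ((SymbolBound.const_mul_rpow (k := 0) hr₀ |C / (2 * α - 1 - α')|
      (2 * α - 1)).mono hr₀ (le_max_left (2 * α - 1) α'))
    refine ⟨E, fun r hr => le_trans ?_ ((le_abs_self _).trans (hE r hr))⟩
    have hr0 : 0 < r := hr₀.trans_le hr
    have hp := Real.rpow_pos_of_pos hr0 α'
    have h := mul_le_mul_of_nonneg_right (hb r hr) hp.le
    rw [abs_mul, abs_of_pos (Real.rpow_pos_of_pos hr0 (-α')), Real.rpow_neg hr0.le,
      mul_right_comm, inv_mul_cancel₀ hp.ne', one_mul, add_mul, mul_assoc |_| _ (r ^ α'),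
      ← Real.rpow_add hr0, sub_add_cancel] at h
    exact h
  refine ⟨hv, ?_⟩
  have hinv : SymbolBound r₀ 0 (-1) (fun r => r⁻¹) := by
    simpa using SymbolBound.npow_inv (k := 0) hr₀ 1
  refine ((hinv.mul hr₀ ((hw.mono hr₀ (le_max_left _ α')).add (hv.const_mul hr₀ α'))).mono hr₀
    (by linarith)).congr fun r hr => ?_
  have hr0 : 0 < r := hr₀.trans_le hr
  rw [Real.rpow_sub hr0, Real.rpow_one]
  field_simp
  ring

theorem hasDerivWithinAt_iteratedDerivWithin_sub {r₀ α : ℝ} {ψ : ℝ → ℝ} (hr₀ : 0 < r₀)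
    (hψ : ContDiffOn ℝ (⊤ : ℕ∞) ψ (Ici r₀)) (m : ℕ) {r : ℝ} (hr : r₀ ≤ r) :
    HasDerivWithinAt (iteratedDerivWithin m ψ (Ici r₀))
      (iteratedDerivWithin (m + 1) ψ (Ici r₀) r) (Ici r₀) r ∧
    HasDerivWithinAt (fun r => iteratedDerivWithin m ψ (Ici r₀) r
        - (∏ j ∈ Finset.range m, (α - (j : ℝ))) * r ^ (α - (m : ℝ)))
      (iteratedDerivWithin (m + 1) ψ (Ici r₀) r
        - (∏ j ∈ Finset.range (m + 1), (α - (j : ℝ))) * r ^ (α - ((m + 1 : ℕ) : ℝ)))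
      (Ici r₀) r := by
  have h1 : HasDerivWithinAt (iteratedDerivWithin m ψ (Ici r₀))
      (iteratedDerivWithin (m + 1) ψ (Ici r₀) r) (Ici r₀) r := by
    rw [iteratedDerivWithin_succ]
    exact (hψ.differentiableOn_iteratedDerivWithin (by exact_mod_cast WithTop.coe_lt_top m)
      (uniqueDiffOn_Ici r₀) r hr).hasDerivWithinAt
  refine ⟨h1, ?_⟩
  refine (h1.sub ((Real.hasDerivAt_rpow_const (p := α - m)
    (Or.inl (hr₀.trans_le hr).ne')).const_mul _).hasDerivWithinAt).congr_deriv ?_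
  rw [Finset.prod_range_succ]
  push_cast
  rw [sub_sub, mul_assoc]

/-- asymptotic expansion, with error `O(r^{α̃−m})`, of all derivatives of a
solution `ψ` of the minimal-surface ODE written as a graph over the Lawson cone ray,
assuming `ψ(r) ∼ r^α` and `ψ'(r) ∼ α r^{α−1}` at infinity. -/
theorem stmt_1 (n p q : ℕ) (hn : 8 ≤ n) (hp : 2 ≤ p) (hq : 2 ≤ q)
    (hpq : p + q = n) (h8 : n = 8 → 3 ≤ p ∧ 3 ≤ q)
    (D α α' αt μ : ℝ)
    (hD : D = (n : ℝ) ^ 2 - 10 * (n : ℝ) + 17)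
    (hα : α = (3 - (n : ℝ) + Real.sqrt D) / 2)
    (hα' : α' = (3 - (n : ℝ) - Real.sqrt D) / 2)
    (hαt : αt = max (2 * α - 1) α')
    (hμ : μ = Real.sqrt (((q : ℝ) - 1) / ((p : ℝ) - 1)))
    (r₀ : ℝ) (hr₀ : 0 < r₀)
    (ψ : ℝ → ℝ) (hψ : ContDiffOn ℝ (⊤ : ℕ∞) ψ (Ici r₀))
    (hpos₁ : ∀ r ≥ r₀, 0 < r - μ * ψ r)
    (hpos₂ : ∀ r ≥ r₀, 0 < μ * r + ψ r)
    (hode : ∀ r ≥ r₀,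
      iteratedDerivWithin 2 ψ (Ici r₀) r / (1 + (iteratedDerivWithin 1 ψ (Ici r₀) r) ^ 2)
        + ((p : ℝ) - 1) * (μ + iteratedDerivWithin 1 ψ (Ici r₀) r) / (r - μ * ψ r)
        - ((q : ℝ) - 1) * (1 - μ * iteratedDerivWithin 1 ψ (Ici r₀) r) / (μ * r + ψ r) = 0)
    (hlim₀ : Tendsto (fun r => ψ r / r ^ α) atTop (nhds 1))
    (hlim₁ : Tendsto (fun r => iteratedDerivWithin 1 ψ (Ici r₀) r / r ^ (α - 1))
      atTop (nhds α)) :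
    ∀ m : ℕ, ∃ C : ℝ, 0 < C ∧ ∀ r ≥ r₀,
      |iteratedDerivWithin m ψ (Ici r₀) r
        - (∏ j ∈ Finset.range m, (α - (j : ℝ))) * r ^ (α - (m : ℝ))|
        ≤ C * r ^ (αt - (m : ℝ)) := by
  have hn' : (8 : ℝ) ≤ n := by exact_mod_cast hn
  have hN : (p : ℝ) - 1 + ((q : ℝ) - 1) = n - 2 := by
    rw [← hpq]; push_cast; ring
  have hp1 : (0 : ℝ) < (p : ℝ) - 1 := by
    have : (2 : ℝ) ≤ p := by exact_mod_cast hp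
    linarith
  have hq1 : (0 : ℝ) < (q : ℝ) - 1 := by
    have : (2 : ℝ) ≤ q := by exact_mod_cast hq
    linarith
  have hμ0 : 0 < μ := by rw [hμ]; positivity
  have hμsq : (q : ℝ) - 1 = ((p : ℝ) - 1) * μ ^ 2 := by
    rw [hμ, Real.sq_sqrt (by positivity)]; field_simp
  have hD0 : 0 ≤ D := by rw [hD]; nlinarith
  have hsq : Real.sqrt D ^ 2 = D := Real.sq_sqrt hD0
  have hα1 : α < 1 := by
    have : Real.sqrt D < n - 1 := (Real.sqrt_lt' (by linarith)).2 (by rw [hD]; nlinarith)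
    rw [hα]; linarith
  have hsum : α + α' = 1 - ((p : ℝ) - 1 + ((q : ℝ) - 1)) := by rw [hN, hα, hα']; ring
  have hprod : α * α' = (p : ℝ) - 1 + ((q : ℝ) - 1) := by
    rw [hN, hα, hα']
    linear_combination (-1 / 4) * hsq - (1 / 4) * hD
  have hres : 2 * α - 1 ≠ α' := by
    intro h
    have h3 : 3 * Real.sqrt D = n - 1 := by rw [hα, hα'] at h; linarith
    have h4 : (n : ℝ) ^ 2 - 11 * n + 19 = 0 := by
      have : (3 * Real.sqrt D) ^ 2 = ((n : ℝ) - 1) ^ 2 := by rw [h3]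
      rw [mul_pow, hsq, hD] at this
      linarith
    have h5 : (n : ℤ) ^ 2 - 11 * n + 19 = 0 := by exact_mod_cast h4
    rcases hn.eq_or_lt with h | h
    · subst h; norm_num at h5
    · have : (9 : ℤ) ≤ n := by exact_mod_cast h
      nlinarith
  have hder := fun (m : ℕ) (r : ℝ) (hr : r ≥ r₀) =>
    hasDerivWithinAt_iteratedDerivWithin_sub (α := α) hr₀ hψ m hr
  set y := iteratedDerivWithin 1 ψ (Ici r₀)
  set z := iteratedDerivWithin 2 ψ (Ici r₀)
  have hu : ∀ r ≥ r₀, HasDerivWithinAt ψ (y r) (Ici r₀) r := fun r hr => by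
    simpa only [iteratedDerivWithin_zero] using (hder 0 r hr).1
  have hy : ∀ r ≥ r₀, HasDerivWithinAt y (z r) (Ici r₀) r := fun r hr => (hder 1 r hr).1
  have hψc : ContinuousOn ψ (Ici r₀) := fun r hr => (hu r hr).continuousWithinAt
  have hyc : ContinuousOn y (Ici r₀) := fun r hr => (hy r hr).continuousWithinAt
  have hz : ∀ r ≥ r₀, z r = quadraticRemainder ((p : ℝ) - 1 + ((q : ℝ) - 1)) μ ψ y r
      - ((p : ℝ) - 1 + ((q : ℝ) - 1)) * ((r ^ 2)⁻¹ * (ψ r + r * y r)) := fun r hr =>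
    eq_quadraticRemainder_sub_of_ode (hr₀.trans_le hr) hμsq (hpos₁ r hr) (hpos₂ r hr) (hode r hr)
  have hinv := exists_inv_mul_bound hr₀ hα1 hμ0 hψc hlim₀ hpos₁ hpos₂
  have hψy := SymbolBound.bootstrap hr₀ hu hy hz
    (fun k h0 h1 => (h0.quadraticRemainder hr₀ hα1.le h1 hpos₁ hpos₂ hinv).mono hr₀
      (by linarith))
    (exists_bound_of_tendsto_div_rpow hr₀ hψc hlim₀)
    (exists_bound_of_tendsto_div_rpow hr₀ hyc hlim₁)
  have hf : ∀ k, SymbolBound r₀ k (2 * α - 3)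
      (quadraticRemainder ((p : ℝ) - 1 + ((q : ℝ) - 1)) μ ψ y) := fun k =>
    (hψy k).1.quadraticRemainder hr₀ hα1.le (hψy k).2 hpos₁ hpos₂ hinv
  obtain ⟨hv0, hv1⟩ := symbolBound_sub_rpow hr₀ hα1 hsum hprod hres hu hy hz (hf 0) hlim₀ hlim₁
  rw [← hαt] at hv0 hv1
  have hle : 2 * α - 1 ≤ αt := hαt ▸ le_max_left _ _
  have hv := SymbolBound.bootstrap (z := fun r => z r - α * (α - 1) * r ^ (α - 2))
    (f := quadraticRemainder ((p : ℝ) - 1 + ((q : ℝ) - 1)) μ ψ y)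
    (N := (p : ℝ) - 1 + ((q : ℝ) - 1)) hr₀
    (fun r hr => by simpa [-iteratedDerivWithin_one] using (hder 0 r hr).2)
    (fun r hr => by
      simpa [Finset.prod_range_succ, -iteratedDerivWithin_one] using (hder 1 r hr).2)
    (fun r hr => by
      have hr0 : 0 < r := hr₀.trans_le hr
      rw [hz r hr, Real.rpow_sub hr0, Real.rpow_sub hr0, Real.rpow_one, Real.rpow_two]
      field_simp
      linear_combination r ^ α * hprod - α * r ^ α * hsum)
    (fun k _ _ => (hf k).mono hr₀ (by linarith)) hv0 hv1
  intro m
  have hm := SymbolBound.bound_iterate (j := 0) (k := m) (β := αt)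
    (fun m r hr => (hder m r hr).2) (by simpa using (hv m).1)
  obtain ⟨C, hC, hbd⟩ := hm.bound_pos hr₀
  exact ⟨C, hC, by simpa using hbd⟩
end

section
/- For every integer i ≥ 0 and every y > 0, the function φ_i(y) = y^α M(−i, b; y²/4) satisfies the eigenvalue equation φ_i''(y) + ((n − 2)/y − y/2) φ_i'(y) + ((n − 2)/y² + 1/2) φ_i(y) + λ_i φ_i(y) = 0, where λ_i = −(1 − α)/2 + i. -/
/-- The coefficient of `x ^ j` in the Kummer polynomial `M(-i, b; x)`. -/
noncomputable def kummerCoeff (i : ℕ) (b : ℝ) (j : ℕ) : ℝ :=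
  (-1 : ℝ) ^ j * (i.choose j : ℝ) / ∏ k ∈ Finset.range j, (b + (k : ℝ))

/-- The Kummer polynomial `M(-i, b; x)`. -/
noncomputable def kummerPoly (i : ℕ) (b : ℝ) : Polynomial ℝ :=
  ∑ j ∈ Finset.range (i + 1), Polynomial.monomial j (kummerCoeff i b j)

theorem kummerCoeff_succ (i : ℕ) {b : ℝ} (hb : 0 < b) (j : ℕ) :
    kummerCoeff i b (j + 1) * ((j + 1) * (b + j)) = -((i - j) * kummerCoeff i b j) := by
  have hbj : b + (j : ℝ) ≠ 0 := by positivity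
  have hprod : ∏ k ∈ Finset.range j, (b + (k : ℝ)) ≠ 0 :=
    Finset.prod_ne_zero_iff.mpr fun k _ => by positivity
  have hchoose : (i.choose (j + 1) : ℝ) * (j + 1) = i.choose j * (i - j) := by
    rcases le_or_gt j i with h | h
    · have := Nat.choose_succ_right_eq i j
      rw [← Nat.cast_sub h]
      exact_mod_cast this
    · simp [Nat.choose_eq_zero_of_lt h, Nat.choose_eq_zero_of_lt (Nat.lt_succ_of_lt h)]
  unfold kummerCoeff
  rw [Finset.prod_range_succ, pow_succ]
  field_simp
  linear_combination -hchoose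

theorem kummerPoly_eval (i : ℕ) (b x : ℝ) :
    (kummerPoly i b).eval x = ∑ j ∈ Finset.range (i + 1), kummerCoeff i b j * x ^ j := by
  simp [kummerPoly, Polynomial.eval_finsetSum]

/-- Kummer's differential equation `x M'' + (b - x) M' + i M = 0` for `M(-i, b; x)`. -/
theorem kummerPoly_ode (i : ℕ) {b : ℝ} (hb : 0 < b) (x : ℝ) :
    x * (kummerPoly i b).derivative.derivative.eval x
      + (b - x) * (kummerPoly i b).derivative.eval x + i * (kummerPoly i b).eval x = 0 := by
  have hterm : ∀ j ∈ Finset.range (i + 1),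
      x * (kummerCoeff i b j * j * (j - 1 : ℕ) * x ^ (j - 1 - 1))
        + (b - x) * (kummerCoeff i b j * j * x ^ (j - 1)) + i * (kummerCoeff i b j * x ^ j)
      = kummerCoeff i b j * (j * (b + j - 1)) * x ^ (j - 1)
        - kummerCoeff i b (j + 1) * ((j + 1 : ℕ) * (b + (j + 1 : ℕ) - 1)) * x ^ (j + 1 - 1) := by
    intro j _
    have hsucc := kummerCoeff_succ i hb j
    rcases j with _ | _ | j <;> push_cast at hsucc ⊢ <;> norm_num at hsucc ⊢
    · linear_combination hsucc
    · linear_combination x * hsucc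
    · linear_combination x ^ (j + 2) * hsucc
  have hsum := Finset.sum_range_sub' (fun j : ℕ =>
    kummerCoeff i b j * (j * (b + j - 1)) * x ^ (j - 1)) (i + 1)
  rw [← Finset.sum_congr rfl hterm] at hsum
  have hlast : kummerCoeff i b (i + 1) = 0 := by simp [kummerCoeff]
  simp only [Finset.sum_add_distrib, ← Finset.mul_sum, hlast, Nat.cast_zero, zero_mul, mul_zero,
    sub_zero] at hsum
  simpa [kummerPoly, Polynomial.derivative_monomial, Polynomial.eval_finsetSum] using hsum

/-- The derivative of `y ^ a * P (y ^ 2 / 4)` for a polynomial `P`. -/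
theorem hasDerivAt_rpow_mul_eval_sq_div_four (P : Polynomial ℝ) (a : ℝ) {y : ℝ} (hy : 0 < y) :
    HasDerivAt (fun y : ℝ => y ^ a * P.eval (y ^ 2 / 4))
      (a * (y ^ (a - 1) * P.eval (y ^ 2 / 4))
        + 1 / 2 * (y ^ (a + 1) * P.derivative.eval (y ^ 2 / 4))) y := by
  have hsq : HasDerivAt (fun y : ℝ => y ^ 2 / 4) (y / 2) y := by
    refine ((hasDerivAt_pow 2 y).div_const 4).congr_deriv ?_
    norm_num
    ring
  have hP : HasDerivAt (fun y : ℝ => P.eval (y ^ 2 / 4))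
      (P.derivative.eval (y ^ 2 / 4) * (y / 2)) y :=
    HasDerivAt.comp (h₂ := fun x => P.eval x) y (P.hasDerivAt (y ^ 2 / 4)) hsq
  refine ((Real.hasDerivAt_rpow_const (p := a) (Or.inl hy.ne')).mul hP).congr_deriv ?_
  rw [Real.rpow_add_one hy.ne']
  ring


/-- the eigenfunctions `φ_i(y) = y^α M(−i, b; y²/4)` built from the Kummer
polynomials satisfy `φ_i'' + ((n−2)/y − y/2) φ_i' + ((n−2)/y² + 1/2) φ_i + λ_i φ_i = 0`
for every `y > 0`, where `λ_i = −(1−α)/2 + i`. -/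
theorem stmt_2 (n : ℕ) (hn : 8 ≤ n)
    (α b : ℝ)
    (hα : α = (3 - (n : ℝ) + Real.sqrt ((n : ℝ) ^ 2 - 10 * (n : ℝ) + 17)) / 2)
    (hb : b = α + ((n : ℝ) - 1) / 2)
    (i : ℕ) (lam : ℝ) (hlam : lam = -(1 - α) / 2 + (i : ℝ))
    (M φ : ℝ → ℝ)
    (hM : ∀ x : ℝ, M x = ∑ j ∈ Finset.range (i + 1),
      (-1 : ℝ) ^ j * (i.choose j : ℝ) * x ^ j / ∏ k ∈ Finset.range j, (b + (k : ℝ)))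
    (hφ : ∀ y : ℝ, φ y = y ^ α * M (y ^ 2 / 4)) :
    ∀ y : ℝ, 0 < y →
      deriv (deriv φ) y + (((n : ℝ) - 2) / y - y / 2) * deriv φ y
        + (((n : ℝ) - 2) / y ^ 2 + 1 / 2) * φ y + lam * φ y = 0 := by
  intro y hy
  have hD : 0 ≤ (n : ℝ) ^ 2 - 10 * (n : ℝ) + 17 := by
    have : (8 : ℝ) ≤ n := by exact_mod_cast hn
    nlinarith
  have hb_pos : 0 < b := by
    have := Real.sqrt_nonneg ((n : ℝ) ^ 2 - 10 * (n : ℝ) + 17)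
    rw [hb, hα]
    linarith
  have hroot : α * (α - 1) + ((n : ℝ) - 2) * (α + 1) = 0 := by
    rw [hα]
    linear_combination Real.sq_sqrt hD / 4
  have hφ_eq : φ = fun y => y ^ α * (kummerPoly i b).eval (y ^ 2 / 4) := by
    funext z
    rw [hφ, hM, kummerPoly_eval]
    congr 1
    refine Finset.sum_congr rfl fun j _ => ?_
    rw [kummerCoeff]
    ring
  have hode := kummerPoly_ode i hb_pos (y ^ 2 / 4)
  set P := kummerPoly i b
  have hderiv : ∀ z : ℝ, 0 < z → deriv φ z =
      α * (z ^ (α - 1) * P.eval (z ^ 2 / 4))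
        + 1 / 2 * (z ^ (α + 1) * P.derivative.eval (z ^ 2 / 4)) := fun z hz => by
    rw [hφ_eq]
    exact (hasDerivAt_rpow_mul_eval_sq_div_four P α hz).deriv
  have hderiv2 := (((hasDerivAt_rpow_mul_eval_sq_div_four P (α - 1) hy).const_mul α).add
    ((hasDerivAt_rpow_mul_eval_sq_div_four P.derivative (α + 1) hy).const_mul
      (1 / 2))).congr_of_eventuallyEq
    ((eventually_gt_nhds hy).mono fun z hz => hderiv z hz)
  have h1 : y ^ (α - 1) = y ^ α / y := Real.rpow_sub_one hy.ne' α
  have h2 : y ^ (α - 1 - 1) = y ^ α / y / y := by rw [Real.rpow_sub_one hy.ne', h1]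
  have h3 : y ^ (α + 1) = y ^ α * y := Real.rpow_add_one hy.ne' α
  have h4 : y ^ (α + 1 + 1) = y ^ α * y * y := by rw [Real.rpow_add_one hy.ne', h3]
  rw [hderiv2.deriv, hderiv y hy, congrFun hφ_eq y, h2, h4, sub_add_cancel, add_sub_cancel_right, h1, h3,
    hlam]
  rw [hb] at hode
  generalize P.eval (y ^ 2 / 4) = p at *
  generalize P.derivative.eval (y ^ 2 / 4) = p' at *
  generalize P.derivative.derivative.eval (y ^ 2 / 4) = p'' at *
  field_simp
  linear_combination y ^ α * (4 * y ^ 2 * hode + 4 * p * hroot)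
end

section
/- For every real ν ≥ 0 there exists a constant C(ν) > 0 such that for all x > 0, 0 < I_ν(x) ≤ C(ν) · x^ν e^x / (x + 1)^{ν + 1/2}. -/
/-- A form of Bernoulli's inequality: `(1 + 1 / (b + ν)) ^ ν ≤ 1 + ν / b`. -/
lemma one_add_inv_rpow_le {b ν : ℝ} (hb : 0 < b) (hν : 0 ≤ ν) :
    ((b + ν + 1) / (b + ν)) ^ ν ≤ (b + ν) / b := by
  have ha : 0 < b + ν := by positivity
  have hlog := Real.one_sub_inv_le_log_of_pos (x := (b + ν) / b) (by positivity)
  have hlog' := Real.log_le_sub_one_of_pos (x := (b + ν + 1) / (b + ν)) (by positivity)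
  rw [Real.rpow_def_of_pos (by positivity), ← Real.le_log_iff_exp_le (by positivity)]
  calc Real.log ((b + ν + 1) / (b + ν)) * ν
      ≤ ((b + ν + 1) / (b + ν) - 1) * ν := by gcongr
    _ = 1 - ((b + ν) / b)⁻¹ := by field_simp; ring
    _ ≤ _ := hlog

lemma factorial_mul_rpow_le_Gamma {ν : ℝ} (hν : 0 ≤ ν) (m : ℕ) :
    Real.Gamma (ν + 1) / (ν + 1) ^ ν * ((m.factorial : ℝ) * ((m : ℝ) + 1 + ν) ^ ν) ≤
      Real.Gamma ((m : ℝ) + ν + 1) := by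
  have hν1 : (0 : ℝ) < (ν + 1) ^ ν := by positivity
  have hG : 0 < Real.Gamma (ν + 1) := Real.Gamma_pos_of_pos (by positivity)
  induction m with
  | zero =>
    simp only [Nat.factorial_zero, Nat.cast_one, Nat.cast_zero, zero_add, one_mul, add_comm 1 ν]
    rw [div_mul_cancel₀ _ hν1.ne']
  | succ m ih =>
    have hb : (0 : ℝ) < (m : ℝ) + 1 := by positivity
    have hstep := one_add_inv_rpow_le hb hν
    rw [Real.div_rpow (by positivity) (by positivity), div_le_div_iff₀ (by positivity) hb] at hstep
    have hrec : Real.Gamma (((m + 1 : ℕ) : ℝ) + ν + 1) =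
        ((m : ℝ) + 1 + ν) * Real.Gamma ((m : ℝ) + ν + 1) := by
      rw [Real.Gamma_add_one (by positivity)]
      push_cast
      ring_nf
    rw [hrec, Nat.factorial_succ]
    push_cast
    calc Real.Gamma (ν + 1) / (ν + 1) ^ ν *
          (((m : ℝ) + 1) * (m.factorial : ℝ) * ((m : ℝ) + 1 + 1 + ν) ^ ν)
        = Real.Gamma (ν + 1) / (ν + 1) ^ ν * (m.factorial : ℝ) *
          (((m : ℝ) + 1 + ν + 1) ^ ν * ((m : ℝ) + 1)) := by ring_nf
      _ ≤ Real.Gamma (ν + 1) / (ν + 1) ^ ν * (m.factorial : ℝ) *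
          (((m : ℝ) + 1 + ν) * ((m : ℝ) + 1 + ν) ^ ν) := by gcongr
      _ = ((m : ℝ) + 1 + ν) * (Real.Gamma (ν + 1) / (ν + 1) ^ ν *
          ((m.factorial : ℝ) * ((m : ℝ) + 1 + ν) ^ ν)) := by ring
      _ ≤ _ := by gcongr

lemma centralBinom_sq_mul_succ_le (m : ℕ) : m.centralBinom ^ 2 * (m + 1) ≤ 16 ^ m := by
  induction m with
  | zero => simp
  | succ m ih =>
    have hrec := Nat.succ_mul_centralBinom_succ m
    have hpos : 0 < (m + 1) ^ 3 := by positivity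
    refine Nat.le_of_mul_le_mul_left ?_ hpos
    calc (m + 1) ^ 3 * ((m + 1).centralBinom ^ 2 * (m + 1 + 1))
        = ((m + 1) * (m + 1).centralBinom) ^ 2 * ((m + 1) * (m + 2)) := by ring
      _ = m.centralBinom ^ 2 * (m + 1) * (4 * ((2 * m + 1) ^ 2 * (m + 2))) := by rw [hrec]; ring
      _ ≤ 16 ^ m * (4 * (4 * (m + 1) ^ 3)) := by
        gcongr ?_ * (4 * ?_)
        nlinarith
      _ = _ := by ring

lemma factorial_two_mul_mul_sqrt_le (m : ℕ) :
    ((2 * m).factorial : ℝ) * √((m : ℝ) + 1) ≤ 4 ^ m * (m.factorial : ℝ) ^ 2 := by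
  have hfac : ((2 * m).factorial : ℝ) = m.centralBinom * (m.factorial : ℝ) ^ 2 := by
    have h := Nat.choose_mul_factorial_mul_factorial (n := 2 * m) (k := m) (by lia)
    rw [← Nat.centralBinom_eq_two_mul_choose, show 2 * m - m = m by lia] at h
    rw [← h]
    push_cast
    ring
  have hcb : (m.centralBinom : ℝ) * √((m : ℝ) + 1) ≤ 4 ^ m := by
    rw [← pow_le_pow_iff_left₀ (by positivity) (by positivity) two_ne_zero, mul_pow,
      Real.sq_sqrt (by positivity), ← pow_mul, mul_comm m 2, pow_mul]
    norm_num
    exact_mod_cast centralBinom_sq_mul_succ_le m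
  calc ((2 * m).factorial : ℝ) * √((m : ℝ) + 1)
      = (m.centralBinom * √((m : ℝ) + 1)) * (m.factorial : ℝ) ^ 2 := by rw [hfac]; ring
    _ ≤ _ := by gcongr

lemma exists_le_factorial_mul_Gamma {ν : ℝ} (hν : 0 ≤ ν) :
    ∃ c : ℝ, 0 < c ∧ ∀ m : ℕ, c * (((2 * m).factorial : ℝ) * ((m : ℝ) + 1) ^ (ν + 1 / 2)) ≤
      4 ^ m * ((m.factorial : ℝ) * Real.Gamma ((m : ℝ) + ν + 1)) := by
  have hG : 0 < Real.Gamma (ν + 1) := Real.Gamma_pos_of_pos (by positivity)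
  refine ⟨Real.Gamma (ν + 1) / (ν + 1) ^ ν, by positivity, fun m ↦ ?_⟩
  set c := Real.Gamma (ν + 1) / (ν + 1) ^ ν with hc
  have hc0 : 0 < c := by positivity
  have hmono : ((m : ℝ) + 1) ^ ν ≤ ((m : ℝ) + 1 + ν) ^ ν :=
    Real.rpow_le_rpow (by positivity) (le_add_of_nonneg_right hν) hν
  calc c * (((2 * m).factorial : ℝ) * ((m : ℝ) + 1) ^ (ν + 1 / 2))
      = c * ((((2 * m).factorial : ℝ) * √((m : ℝ) + 1)) * ((m : ℝ) + 1) ^ ν) := by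
        rw [Real.rpow_add (by positivity), ← Real.sqrt_eq_rpow]
        ring
    _ ≤ c * ((4 ^ m * (m.factorial : ℝ) ^ 2) * ((m : ℝ) + 1 + ν) ^ ν) := by
        gcongr c * (?_ * ?_)
        exact factorial_two_mul_mul_sqrt_le m
    _ = 4 ^ m * ((m.factorial : ℝ) * (c * ((m.factorial : ℝ) * ((m : ℝ) + 1 + ν) ^ ν))) := by ring
    _ ≤ _ := by
        gcongr
        exact factorial_mul_rpow_le_Gamma hν m

lemma rpow_le_one_add_pow {r s : ℝ} {N : ℕ} (hr : 0 ≤ r) (hs : 0 ≤ s) (hN : s ≤ N) :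
    r ^ s ≤ 1 + r ^ N := by
  rcases le_total r 1 with h | h
  · linarith [Real.rpow_le_one hr h hs, pow_nonneg hr N]
  · have := Real.rpow_le_rpow_of_exponent_le h hN
    rw [Real.rpow_natCast] at this
    linarith

lemma factorial_two_mul_add_le (m N : ℕ) :
    (2 * m + N).factorial ≤ (2 * m).factorial * ((N + 2) ^ N * (m + 1) ^ N) := by
  rw [← Nat.factorial_mul_ascFactorial, ← mul_pow]
  gcongr
  refine (Nat.ascFactorial_le_pow_add _ _).trans ?_
  gcongr
  nlinarith [Nat.zero_le (N * m)]

lemma pow_div_factorial_mul_rpow_le {s x : ℝ} {N : ℕ} (hs : 0 ≤ s) (hN : s ≤ N) (hx : 0 < x)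
    (m : ℕ) :
    x ^ (2 * m) / (((2 * m).factorial : ℝ) * ((m : ℝ) + 1) ^ s) * (x + 1) ^ s ≤
      (1 + 2 ^ N) * (x ^ (2 * m) / ((2 * m).factorial : ℝ)) +
      2 ^ N * (N + 2) ^ N * (x ^ (2 * m + N) / ((2 * m + N).factorial : ℝ)) := by
  have hm : (1 : ℝ) ≤ ((m : ℝ) + 1) ^ N := one_le_pow₀ (by linarith [Nat.cast_nonneg (α := ℝ) m])
  have hadd : (x + 1) ^ N ≤ 2 ^ N * (x ^ N + 1) := by
    have h := add_pow_le hx.le zero_le_one N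
    rw [one_pow] at h
    refine h.trans ?_
    gcongr
    · norm_num
    · lia
  have hfac : x ^ (2 * m + N) / (((2 * m).factorial : ℝ) * ((m : ℝ) + 1) ^ N) ≤
      (N + 2) ^ N * (x ^ (2 * m + N) / ((2 * m + N).factorial : ℝ)) := by
    have h : ((2 * m + N).factorial : ℝ) ≤
        (2 * m).factorial * ((N + 2) ^ N * ((m : ℝ) + 1) ^ N) := by
      exact_mod_cast factorial_two_mul_add_le m N
    rw [← mul_div_assoc, div_le_div_iff₀ (by positivity) (by positivity)]
    calc x ^ (2 * m + N) * ((2 * m + N).factorial : ℝ)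
        ≤ x ^ (2 * m + N) * ((2 * m).factorial * ((N + 2) ^ N * ((m : ℝ) + 1) ^ N)) := by gcongr
      _ = _ := by ring
  have hlow : x ^ (2 * m) / (((2 * m).factorial : ℝ) * ((m : ℝ) + 1) ^ N) ≤
      x ^ (2 * m) / ((2 * m).factorial : ℝ) := by
    gcongr
    exact le_mul_of_one_le_right (by positivity) hm
  calc x ^ (2 * m) / (((2 * m).factorial : ℝ) * ((m : ℝ) + 1) ^ s) * (x + 1) ^ s
      = x ^ (2 * m) / ((2 * m).factorial : ℝ) * ((x + 1) / ((m : ℝ) + 1)) ^ s := by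
        rw [Real.div_rpow (by positivity) (by positivity)]
        field_simp
    _ ≤ x ^ (2 * m) / ((2 * m).factorial : ℝ) * (1 + ((x + 1) / ((m : ℝ) + 1)) ^ N) := by
        gcongr
        exact rpow_le_one_add_pow (by positivity) hs hN
    _ = x ^ (2 * m) / ((2 * m).factorial : ℝ) +
        x ^ (2 * m) / (((2 * m).factorial : ℝ) * ((m : ℝ) + 1) ^ N) * (x + 1) ^ N := by
        rw [div_pow]
        field_simp
    _ ≤ x ^ (2 * m) / ((2 * m).factorial : ℝ) +
        x ^ (2 * m) / (((2 * m).factorial : ℝ) * ((m : ℝ) + 1) ^ N) * (2 ^ N * (x ^ N + 1)) := by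
        gcongr
    _ = x ^ (2 * m) / ((2 * m).factorial : ℝ) +
        2 ^ N * (x ^ (2 * m) / (((2 * m).factorial : ℝ) * ((m : ℝ) + 1) ^ N)) +
        2 ^ N * (x ^ (2 * m + N) / (((2 * m).factorial : ℝ) * ((m : ℝ) + 1) ^ N)) := by
        rw [pow_add]
        ring
    _ ≤ x ^ (2 * m) / ((2 * m).factorial : ℝ) + 2 ^ N * (x ^ (2 * m) / ((2 * m).factorial : ℝ)) +
        2 ^ N * ((N + 2) ^ N * (x ^ (2 * m + N) / ((2 * m + N).factorial : ℝ))) := by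
        gcongr
    _ = _ := by ring

lemma summable_pow_div_factorial_comp {i : ℕ → ℕ} (hi : i.Injective) (x : ℝ) :
    Summable fun m ↦ x ^ i m / ((i m).factorial : ℝ) :=
  (Real.summable_pow_div_factorial x).comp_injective hi

lemma tsum_pow_div_factorial_comp_le_exp {i : ℕ → ℕ} (hi : i.Injective) {x : ℝ} (hx : 0 ≤ x) :
    ∑' m, x ^ i m / ((i m).factorial : ℝ) ≤ Real.exp x := by
  rw [Real.exp_eq_exp_ℝ, ← (NormedSpace.expSeries_div_hasSum_exp x).tsum_eq]
  exact tsum_comp_le_tsum_of_inj (Real.summable_pow_div_factorial x) (fun n ↦ by positivity) hi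

lemma besselI_term_le {ν c x : ℝ} (hν : 0 ≤ ν) (hc : 0 < c) (hx : 0 < x) (m : ℕ)
    (h : c * (((2 * m).factorial : ℝ) * ((m : ℝ) + 1) ^ (ν + 1 / 2)) ≤
      4 ^ m * ((m.factorial : ℝ) * Real.Gamma ((m : ℝ) + ν + 1))) :
    (x / 2) ^ (2 * (m : ℝ) + ν) / ((m.factorial : ℝ) * Real.Gamma ((m : ℝ) + ν + 1)) ≤
      x ^ ν / c * (x ^ (2 * m) / (((2 * m).factorial : ℝ) * ((m : ℝ) + 1) ^ (ν + 1 / 2))) := by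
  have hG : 0 < Real.Gamma ((m : ℝ) + ν + 1) := Real.Gamma_pos_of_pos (by positivity)
  have hpow : (x / 2) ^ (2 * (m : ℝ) + ν) ≤ x ^ ν * x ^ (2 * m) / 4 ^ m := by
    have h2 : (x / 2) ^ (2 * (m : ℝ)) = x ^ (2 * m) / 4 ^ m := by
      rw [show 2 * (m : ℝ) = ((2 * m : ℕ) : ℝ) by push_cast; ring, Real.rpow_natCast, div_pow,
        pow_mul 2]
      norm_num
    rw [Real.rpow_add (by positivity), h2, mul_comm, mul_div_assoc]
    gcongr
    linarith
  calc _ ≤ x ^ ν * x ^ (2 * m) / 4 ^ m /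
        ((m.factorial : ℝ) * Real.Gamma ((m : ℝ) + ν + 1)) := by gcongr
    _ = x ^ ν * x ^ (2 * m) / (4 ^ m * ((m.factorial : ℝ) * Real.Gamma ((m : ℝ) + ν + 1))) := by
        rw [div_div]
    _ ≤ x ^ ν * x ^ (2 * m) / (c * (((2 * m).factorial : ℝ) * ((m : ℝ) + 1) ^ (ν + 1 / 2))) := by
        gcongr
    _ = _ := by rw [div_mul_div_comm]

/-- for every `ν ≥ 0` there is `C(ν) > 0` such that the modified Bessel
function of the first kind satisfies `0 < I_ν(x) ≤ C(ν) x^ν e^x / (x+1)^{ν+1/2}` for all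
`x > 0`. -/
theorem stmt_7 (I : ℝ → ℝ → ℝ)
    (hI : ∀ ν x : ℝ, I ν x = ∑' m : ℕ,
      (x / 2) ^ (2 * (m : ℝ) + ν) / ((m.factorial : ℝ) * Real.Gamma ((m : ℝ) + ν + 1))) :
    ∀ ν : ℝ, 0 ≤ ν → ∃ C : ℝ, 0 < C ∧ ∀ x : ℝ, 0 < x →
      0 < I ν x ∧ I ν x ≤ C * x ^ ν * Real.exp x / (x + 1) ^ (ν + 1 / 2) := by
  intro ν hν
  obtain ⟨c, hc, hcm⟩ := exists_le_factorial_mul_Gamma hν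
  obtain ⟨N, hN⟩ := exists_nat_ge (ν + 1 / 2)
  refine ⟨((1 + 2 ^ N) + 2 ^ N * (N + 2) ^ N) / c, by positivity, fun x hx ↦ ?_⟩
  rw [hI]
  have hpos (m : ℕ) : 0 < (x / 2) ^ (2 * (m : ℝ) + ν) /
      ((m.factorial : ℝ) * Real.Gamma ((m : ℝ) + ν + 1)) := by
    have hG : 0 < Real.Gamma ((m : ℝ) + ν + 1) := Real.Gamma_pos_of_pos (by positivity)
    positivity
  set A : ℝ := x ^ ν / c / (x + 1) ^ (ν + 1 / 2) with hA
  have hle (m : ℕ) : (x / 2) ^ (2 * (m : ℝ) + ν) /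
      ((m.factorial : ℝ) * Real.Gamma ((m : ℝ) + ν + 1)) ≤
      A * ((1 + 2 ^ N) * (x ^ (2 * m) / ((2 * m).factorial : ℝ)) +
      2 ^ N * (N + 2) ^ N * (x ^ (2 * m + N) / ((2 * m + N).factorial : ℝ))) := by
    refine (besselI_term_le hν hc hx m (hcm m)).trans ?_
    rw [hA, div_mul_eq_mul_div _ ((x + 1) ^ _), le_div_iff₀ (by positivity), mul_assoc]
    gcongr
    exact pow_div_factorial_mul_rpow_le (by positivity) hN hx m
  have heven : Function.Injective fun m : ℕ ↦ 2 * m := fun a b h ↦ by simpa using h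
  have hshift : Function.Injective fun m : ℕ ↦ 2 * m + N := fun a b h ↦ by simpa using h
  have hs₁ := (summable_pow_div_factorial_comp heven x).mul_left (1 + 2 ^ N)
  have hs₂ := (summable_pow_div_factorial_comp hshift x).mul_left (2 ^ N * ((N : ℝ) + 2) ^ N)
  have hsum := (hs₁.add hs₂).mul_left A
  have hsI := Summable.of_nonneg_of_le (fun m ↦ (hpos m).le) hle hsum
  refine ⟨hsI.tsum_pos (fun m ↦ (hpos m).le) 0 (hpos 0), ?_⟩
  refine (hsI.tsum_le_tsum hle hsum).trans ?_
  rw [tsum_mul_left, hs₁.tsum_add hs₂, tsum_mul_left, tsum_mul_left]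
  calc _ ≤ A * ((1 + 2 ^ N) * Real.exp x + 2 ^ N * (N + 2) ^ N * Real.exp x) := by
        gcongr
        · exact tsum_pow_div_factorial_comp_le_exp heven hx.le
        · exact tsum_pow_div_factorial_comp_le_exp hshift hx.le
    _ = _ := by rw [hA]; ring
end

section
/- There exists a constant C depending only on n such that for all y, z > 0 and all 0 < s ≤ 1, 0 < K(y, z, s) ≤ C · y^α · s^{−((n−1)/2 + α)} · z^{n−2+α} · (1 + (e^{−1/2}/2) · yz/s)^{−(n/2 − 1 + α)} · exp(−(e^{−s/2} y − z)²/(4s)). -/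
/-- A Wendel-type inequality for the Gamma function. -/
lemma rpow_mul_Gamma_le_Gamma_add {a p : ℝ} (ha : 0 < a) (hp : 1 ≤ p) :
    a ^ p * Real.Gamma a ≤ Real.Gamma (a + p) := by
  have hp0 : 0 < p := by linarith
  rcases hp.eq_or_lt with rfl | hp1
  · rw [Real.rpow_one, Real.Gamma_add_one ha.ne']
  have hGa := Real.Gamma_pos_of_pos ha
  have hGp := Real.Gamma_pos_of_pos (add_pos ha hp0)
  have h := Real.Gamma_mul_add_mul_le_rpow_Gamma_mul_rpow_Gamma ha (add_pos ha hp0)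
    (a := 1 - 1 / p) (b := 1 / p)
    (by rw [sub_pos, div_lt_one hp0]; exact hp1) (by positivity) (by ring)
  have e1 : (1 - 1 / p) * a + 1 / p * (a + p) = a + 1 := by field_simp; ring
  rw [e1, Real.Gamma_add_one ha.ne'] at h
  have h2 := Real.rpow_le_rpow (by positivity) h hp0.le
  rw [Real.mul_rpow ha.le hGa.le, Real.mul_rpow (by positivity) (by positivity),
    ← Real.rpow_mul hGa.le, ← Real.rpow_mul hGp.le, one_div_mul_cancel hp0.ne', Real.rpow_one,
    show (1 - 1 / p) * p = p - 1 by field_simp, Real.rpow_sub_one hGa.ne'] at h2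
  have hpp : 0 < Real.Gamma a ^ p := by positivity
  have h3 : a ^ p * Real.Gamma a ^ p * (Real.Gamma a / Real.Gamma a ^ p)
      ≤ Real.Gamma a ^ p / Real.Gamma a * Real.Gamma (a + p)
        * (Real.Gamma a / Real.Gamma a ^ p) :=
    mul_le_mul_of_nonneg_right h2 (by positivity)
  calc a ^ p * Real.Gamma a
      = a ^ p * Real.Gamma a ^ p * (Real.Gamma a / Real.Gamma a ^ p) := by field_simp
    _ ≤ _ := h3
    _ = Real.Gamma (a + p) := by field_simp

/-- The `m`-th coefficient of the Bessel series of order `p - 1 / 2` is dominated by the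
`2 m`-th coefficient of the exponential series damped by `(2 m + 1) ^ (-p)`. -/
lemma besselI_coeff_le {p : ℝ} (hp : 1 ≤ p) (m : ℕ) :
    1 / (4 ^ m * ((m.factorial : ℝ) * Real.Gamma ((m : ℝ) + (p - 1 / 2) + 1)))
      ≤ 2 ^ p / √Real.pi * (1 / (((2 * m).factorial : ℝ) * (2 * (m : ℝ) + 1) ^ p)) := by
  have ha : (0 : ℝ) < m + 1 / 2 := by positivity
  have hW := rpow_mul_Gamma_le_Gamma_add ha hp
  have hD := Real.Gamma_mul_Gamma_add_half ((m : ℝ) + 1 / 2)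
  rw [show (m : ℝ) + 1 / 2 + 1 / 2 = m + 1 by ring, Real.Gamma_nat_eq_factorial,
    show 2 * ((m : ℝ) + 1 / 2) = ((2 * m : ℕ) : ℝ) + 1 by push_cast; ring,
    Real.Gamma_nat_eq_factorial,
    show (1 : ℝ) - (((2 * m : ℕ) : ℝ) + 1) = -((2 * m : ℕ) : ℝ) by ring,
    Real.rpow_neg zero_le_two, Real.rpow_natCast, pow_mul] at hD
  norm_num at hD
  have hG := Real.Gamma_pos_of_pos ha
  have hpi : 0 < √Real.pi := Real.sqrt_pos.mpr Real.pi_pos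
  have hf : (0 : ℝ) < m.factorial := by positivity
  have h2f : (0 : ℝ) < (2 * m).factorial := by positivity
  have h21 : (2 * (m : ℝ) + 1) ^ p = 2 ^ p * ((m : ℝ) + 1 / 2) ^ p := by
    rw [← Real.mul_rpow zero_le_two ha.le]; congr 1; ring
  rw [show (m : ℝ) + (p - 1 / 2) + 1 = m + 1 / 2 + p by ring, h21]
  have hap : (0 : ℝ) < ((m : ℝ) + 1 / 2) ^ p := by positivity
  have h2p : (0 : ℝ) < 2 ^ p := by positivity
  have key : ((2 * m).factorial : ℝ) * √Real.pi
      = 4 ^ m * (Real.Gamma ((m : ℝ) + 1 / 2) * m.factorial) := by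
    norm_num
    rw [hD]; field_simp
  calc 1 / (4 ^ m * ((m.factorial : ℝ) * Real.Gamma ((m : ℝ) + 1 / 2 + p)))
      ≤ 1 / (4 ^ m * ((m.factorial : ℝ) *
          (((m : ℝ) + 1 / 2) ^ p * Real.Gamma ((m : ℝ) + 1 / 2)))) := by gcongr
    _ = 1 / (((2 * m).factorial : ℝ) * √Real.pi * ((m : ℝ) + 1 / 2) ^ p) := by
        rw [key]; congr 1; ring
    _ = _ := by field_simp

lemma factorial_add_le_factorial_mul_pow (k N : ℕ) :
    (k + N).factorial ≤ k.factorial * (N.factorial * (k + 1) ^ N) := by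
  induction N with
  | zero => simp
  | succ N ih =>
    rw [← add_assoc, Nat.factorial_succ, Nat.factorial_succ, pow_succ]
    calc (k + N + 1) * (k + N).factorial
        ≤ ((N + 1) * (k + 1)) * (k.factorial * (N.factorial * (k + 1) ^ N)) := by
          gcongr
          nlinarith [Nat.zero_le (N * k)]
      _ = _ := by ring

lemma exp_term_mul_pow_le {w : ℝ} (hw : 0 < w) (k N : ℕ) :
    w ^ k / k.factorial * ((1 + w) / ((k : ℝ) + 1)) ^ N
      ≤ 2 ^ N * (w ^ k / k.factorial + N.factorial * (w ^ (k + N) / (k + N).factorial)) := by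
  have h1 : (1 + w) ^ N ≤ 2 ^ N * (1 + w ^ N) := by
    have hN : (0 : ℝ) < w ^ N := by positivity
    rcases le_total w 1 with h | h
    · calc (1 + w) ^ N ≤ 2 ^ N := by gcongr; linarith
        _ ≤ _ := le_mul_of_one_le_right (by positivity) (by linarith)
    · calc (1 + w) ^ N ≤ (2 * w) ^ N := by gcongr; linarith
        _ = 2 ^ N * w ^ N := mul_pow _ _ _
        _ ≤ _ := by gcongr; linarith
  have h2 : ((k + N).factorial : ℝ)
      ≤ k.factorial * (N.factorial * ((k : ℝ) + 1) ^ N) := by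
    exact_mod_cast factorial_add_le_factorial_mul_pow k N
  have hone : (1 : ℝ) ≤ ((k : ℝ) + 1) ^ N := one_le_pow₀ (by linarith [k.cast_nonneg (α := ℝ)])
  have h3 : w ^ (k + N) / (k.factorial * ((k : ℝ) + 1) ^ N)
      ≤ N.factorial * (w ^ (k + N) / (k + N).factorial) := by
    rw [← mul_div_assoc, div_le_div_iff₀ (by positivity) (by positivity)]
    calc w ^ (k + N) * ((k + N).factorial : ℝ)
        ≤ w ^ (k + N) * (k.factorial * (N.factorial * ((k : ℝ) + 1) ^ N)) := by gcongr
      _ = _ := by ring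
  have h4 : w ^ k / (k.factorial * ((k : ℝ) + 1) ^ N) ≤ w ^ k / k.factorial := by
    gcongr
    exact le_mul_of_one_le_right (by positivity) hone
  calc w ^ k / k.factorial * ((1 + w) / ((k : ℝ) + 1)) ^ N
      = w ^ k / (k.factorial * ((k : ℝ) + 1) ^ N) * (1 + w) ^ N := by
        rw [div_pow]; field_simp
    _ ≤ w ^ k / (k.factorial * ((k : ℝ) + 1) ^ N) * (2 ^ N * (1 + w ^ N)) := by gcongr
    _ = 2 ^ N * (w ^ k / (k.factorial * ((k : ℝ) + 1) ^ N)
          + w ^ (k + N) / (k.factorial * ((k : ℝ) + 1) ^ N)) := by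
        rw [pow_add]; ring
    _ ≤ _ := by gcongr

lemma rpow_le_one_add_pow_s8 {x p : ℝ} (hx : 0 < x) (hp : 0 ≤ p) {N : ℕ} (hN : p ≤ N) :
    x ^ p ≤ 1 + x ^ N := by
  have hxN : 0 < x ^ N := by positivity
  rcases le_total x 1 with h | h
  · linarith [Real.rpow_le_one hx.le h hp]
  · have := Real.rpow_le_rpow_of_exponent_le h hN
    rw [Real.rpow_natCast] at this
    linarith

lemma tsum_exp_subseries_le {w : ℝ} (hw : 0 < w) (N : ℕ) :
    Summable (fun m : ℕ => w ^ (2 * m + N) / ((2 * m + N).factorial : ℝ)) ∧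
      ∑' m : ℕ, w ^ (2 * m + N) / ((2 * m + N).factorial : ℝ) ≤ Real.exp w := by
  have hs := Real.summable_pow_div_factorial w
  have hinj : Function.Injective (fun m : ℕ => 2 * m + N) := fun a b h => by
    simp only at h; omega
  refine ⟨hs.comp_injective hinj, ?_⟩
  rw [Real.exp_eq_exp_ℝ, NormedSpace.exp_eq_tsum_div]
  exact _root_.tsum_comp_le_tsum_of_inj hs (fun k => by positivity) hinj

/-- The Bessel series of order `p - 1 / 2` converges to a positive number, and it obeys the
uniform bound `I(w) ≤ C w ^ (p - 1 / 2) (1 + w) ^ (-p) exp w`. -/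
lemma exists_besselI_bound {p : ℝ} (hp : 1 ≤ p) :
    ∃ C : ℝ, 0 < C ∧ ∀ w : ℝ, 0 < w →
      0 < ∑' m : ℕ, (w / 2) ^ (2 * (m : ℝ) + (p - 1 / 2)) /
        ((m.factorial : ℝ) * Real.Gamma ((m : ℝ) + (p - 1 / 2) + 1)) ∧
      ∑' m : ℕ, (w / 2) ^ (2 * (m : ℝ) + (p - 1 / 2)) /
        ((m.factorial : ℝ) * Real.Gamma ((m : ℝ) + (p - 1 / 2) + 1))
        ≤ C * (w / 2) ^ (p - 1 / 2) * (1 + w) ^ (-p) * Real.exp w := by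
  obtain ⟨N, hN⟩ := exists_nat_ge p
  have hpi : 0 < √Real.pi := Real.sqrt_pos.mpr Real.pi_pos
  refine ⟨2 ^ p / √Real.pi * (1 + 2 ^ N * (1 + N.factorial)), by positivity, fun w hw => ?_⟩
  set P : ℝ := (w / 2) ^ (p - 1 / 2) with hP
  have hPpos : 0 < P := by positivity
  set B : ℝ := 2 ^ p / √Real.pi * P * (1 + w) ^ (-p) with hB
  have hBpos : 0 < B := by positivity
  have hpos : ∀ m : ℕ, 0 < (w / 2) ^ (2 * (m : ℝ) + (p - 1 / 2)) /
      ((m.factorial : ℝ) * Real.Gamma ((m : ℝ) + (p - 1 / 2) + 1)) := fun m => by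
    have : 0 < Real.Gamma ((m : ℝ) + (p - 1 / 2) + 1) :=
      Real.Gamma_pos_of_pos (by linarith [m.cast_nonneg (α := ℝ)])
    positivity
  have hle : ∀ m : ℕ, (w / 2) ^ (2 * (m : ℝ) + (p - 1 / 2)) /
      ((m.factorial : ℝ) * Real.Gamma ((m : ℝ) + (p - 1 / 2) + 1))
      ≤ B * ((1 + 2 ^ N) * (w ^ (2 * m + 0) / ((2 * m + 0).factorial : ℝ))
        + 2 ^ N * N.factorial * (w ^ (2 * m + N) / ((2 * m + N).factorial : ℝ))) := fun m => by
    have hx : 0 < (1 + w) / (2 * (m : ℝ) + 1) := by positivity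
    have h1 := rpow_le_one_add_pow_s8 hx (by linarith : (0 : ℝ) ≤ p) hN
    have h2 := exp_term_mul_pow_le hw (2 * m) N
    push_cast at h2
    have e1 : (w / 2) ^ (2 * (m : ℝ) + (p - 1 / 2)) = w ^ (2 * m) / 4 ^ m * P := by
      rw [Real.rpow_add (by positivity), ← hP]
      congr 1
      rw [show 2 * (m : ℝ) = ((2 * m : ℕ) : ℝ) by push_cast; ring, Real.rpow_natCast, div_pow,
        pow_mul 2 2 m]
      norm_num
    have e2 : (1 + w) ^ (-p) * ((1 + w) / (2 * (m : ℝ) + 1)) ^ p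
        = 1 / (2 * (m : ℝ) + 1) ^ p := by
      rw [Real.div_rpow (by positivity) (by positivity), Real.rpow_neg (by positivity)]
      field_simp
    calc (w / 2) ^ (2 * (m : ℝ) + (p - 1 / 2)) /
          ((m.factorial : ℝ) * Real.Gamma ((m : ℝ) + (p - 1 / 2) + 1))
        = w ^ (2 * m) * P *
          (1 / (4 ^ m * ((m.factorial : ℝ) * Real.Gamma ((m : ℝ) + (p - 1 / 2) + 1)))) := by
          rw [e1]; ring
      _ ≤ w ^ (2 * m) * P *
          (2 ^ p / √Real.pi * (1 / (((2 * m).factorial : ℝ) * (2 * (m : ℝ) + 1) ^ p))) := by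
          gcongr ?_ * ?_
          exact besselI_coeff_le hp m
      _ = w ^ (2 * m) * P *
          (2 ^ p / √Real.pi * (1 / ((2 * m).factorial : ℝ) * (1 / (2 * (m : ℝ) + 1) ^ p))) := by
          ring
      _ = B * (w ^ (2 * m) / (2 * m).factorial * ((1 + w) / (2 * (m : ℝ) + 1)) ^ p) := by
          rw [← e2, hB]; ring
      _ ≤ B * (w ^ (2 * m) / (2 * m).factorial
            * (1 + ((1 + w) / (2 * (m : ℝ) + 1)) ^ N)) := by gcongr
      _ ≤ _ := by
          gcongr
          rw [mul_add, mul_one]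
          simp only [add_zero]
          linarith
  obtain ⟨s0, t0⟩ := tsum_exp_subseries_le hw 0
  obtain ⟨sN, tN⟩ := tsum_exp_subseries_le hw N
  have hsum := ((s0.mul_left (1 + 2 ^ N)).add
    (sN.mul_left ((2 : ℝ) ^ N * (N.factorial : ℝ)))).mul_left B
  have hS := Summable.of_nonneg_of_le (fun m => (hpos m).le) hle hsum
  refine ⟨hS.tsum_pos (fun m => (hpos m).le) 0 (hpos 0), ?_⟩
  refine (hS.tsum_le_tsum hle hsum).trans ?_
  rw [tsum_mul_left, (s0.mul_left _).tsum_add (sN.mul_left _), tsum_mul_left, tsum_mul_left]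
  calc _ ≤ B * ((1 + 2 ^ N) * Real.exp w + 2 ^ N * N.factorial * Real.exp w) := by gcongr
    _ = _ := by rw [hB]; ring

/-- pointwise upper bound (and positivity) for the heat kernel `K(y, z, s)` of
the linearized operator, for `y, z > 0` and `0 < s ≤ 1`. -/
theorem stmt_8 (n : ℕ) (hn : 8 ≤ n)
    (α γ : ℝ)
    (hα : α = (3 - (n : ℝ) + Real.sqrt ((n : ℝ) ^ 2 - 10 * (n : ℝ) + 17)) / 2)
    (hγ : γ = ((n : ℝ) - 3) / 2 + α)
    (Iγ : ℝ → ℝ)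
    (hI : ∀ x : ℝ, Iγ x = ∑' m : ℕ,
      (x / 2) ^ (2 * (m : ℝ) + γ) / ((m.factorial : ℝ) * Real.Gamma ((m : ℝ) + γ + 1)))
    (K : ℝ → ℝ → ℝ → ℝ)
    (hK : ∀ y z s : ℝ, K y z s
      = (z / y) ^ ((n : ℝ) / 2 - 1) * Real.sqrt (y * z)
        * (Real.exp (((n : ℝ) - 1) * s / 4) / (2 * (1 - Real.exp (-s))))
        * Iγ (Real.exp (-s / 2) * y * z / (2 * (1 - Real.exp (-s))))
        * Real.exp (-(Real.exp (-s) * y ^ 2 + z ^ 2) / (4 * (1 - Real.exp (-s))))) :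
    ∃ C : ℝ, ∀ y z s : ℝ, 0 < y → 0 < z → 0 < s → s ≤ 1 →
      0 < K y z s ∧
      K y z s ≤ C * y ^ α * s ^ (-(((n : ℝ) - 1) / 2 + α)) * z ^ ((n : ℝ) - 2 + α)
        * (1 + Real.exp (-1 / 2) / 2 * (y * z / s)) ^ (-((n : ℝ) / 2 - 1 + α))
        * Real.exp (-(Real.exp (-s / 2) * y - z) ^ 2 / (4 * s)) := by
  have hnR : (8 : ℝ) ≤ n := by exact_mod_cast hn
  have hγ2 : 1 / 2 ≤ γ := by
    have : (1 : ℝ) ≤ Real.sqrt ((n : ℝ) ^ 2 - 10 * (n : ℝ) + 17) :=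
      Real.one_le_sqrt.mpr (by nlinarith)
    linarith
  obtain ⟨C, hC, hbound⟩ := exists_besselI_bound (p := γ + 1 / 2) (by linarith)
  simp only [add_sub_cancel_right, ← hI] at hbound
  refine ⟨Real.exp (((n : ℝ) - 1) / 4) * (Real.exp 1 / 2) * Real.exp 1 ^ γ * C,
    fun y z s hy hz hs hs1 => ?_⟩
  rw [hK]
  set A : ℝ := 1 - Real.exp (-s) with hA
  have hAs : A ≤ s := by linarith [Real.add_one_le_exp (-s)]
  have hsA : s / Real.exp 1 ≤ A := by
    have h1 : (1 + s) * Real.exp (-s) ≤ 1 := by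
      calc (1 + s) * Real.exp (-s) ≤ Real.exp s * Real.exp (-s) := by
            gcongr; linarith [Real.add_one_le_exp s]
        _ = 1 := by rw [← Real.exp_add]; simp
    have h2 : Real.exp (-1) ≤ Real.exp (-s) := Real.exp_le_exp.mpr (by linarith)
    rw [div_eq_mul_inv, ← Real.exp_neg]
    nlinarith
  have hA0 : 0 < A := lt_of_lt_of_le (by positivity) hsA
  set w : ℝ := Real.exp (-s / 2) * y * z / (2 * A) with hw
  have hw0 : 0 < w := by positivity
  obtain ⟨hIpos, hIle⟩ := hbound w hw0
  refine ⟨by positivity, ?_⟩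
  have hinv : 1 / A ≤ Real.exp 1 / s := by
    rw [div_le_div_iff₀ hA0 hs]
    rw [div_le_iff₀ (Real.exp_pos 1)] at hsA
    linarith
  have hwlow : Real.exp (-1 / 2) / 2 * (y * z / s) ≤ w := by
    calc Real.exp (-1 / 2) / 2 * (y * z / s) = Real.exp (-1 / 2) * y * z / (2 * s) := by ring
      _ ≤ Real.exp (-s / 2) * y * z / (2 * A) := by
        gcongr
  have hwup : w / 2 ≤ Real.exp 1 * (y * z / s) := by
    have he : Real.exp (-s / 2) ≤ 1 := Real.exp_le_one_iff.mpr (by linarith)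
    calc w / 2 = Real.exp (-s / 2) * (y * z) * (1 / A) / 4 := by rw [hw]; field_simp; ring
      _ ≤ 1 * (y * z) * (Real.exp 1 / s) / 4 := by gcongr
      _ = (Real.exp 1 * (y * z / s)) / 4 := by ring
      _ ≤ Real.exp 1 * (y * z / s) := by
        linarith [show 0 < Real.exp 1 * (y * z / s) by positivity]
  have hexp : Real.exp w * Real.exp (-(Real.exp (-s) * y ^ 2 + z ^ 2) / (4 * A))
      ≤ Real.exp (-(Real.exp (-s / 2) * y - z) ^ 2 / (4 * s)) := by
    rw [← Real.exp_add, Real.exp_le_exp]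
    have hq : Real.exp (-s) = Real.exp (-s / 2) ^ 2 := by
      rw [← Real.exp_nat_mul]; congr 1; push_cast; ring
    have e : w + -(Real.exp (-s) * y ^ 2 + z ^ 2) / (4 * A)
        = -((Real.exp (-s / 2) * y - z) ^ 2 / (4 * A)) := by
      rw [hw, hq]; field_simp; ring
    rw [e, neg_div _ ((Real.exp (-s / 2) * y - z) ^ 2)]
    gcongr
  have hpow : (z / y) ^ ((n : ℝ) / 2 - 1) * Real.sqrt (y * z) * (1 / s) * (y * z / s) ^ γ
      = y ^ α * s ^ (-(((n : ℝ) - 1) / 2 + α)) * z ^ ((n : ℝ) - 2 + α) := by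
    rw [Real.sqrt_eq_rpow, Real.div_rpow hz.le hy.le, Real.mul_rpow hy.le hz.le,
      Real.div_rpow (by positivity) hs.le, Real.mul_rpow hy.le hz.le,
      show α = -((n : ℝ) / 2 - 1) + 1 / 2 + γ by linarith,
      show (n : ℝ) - 2 + (-((n : ℝ) / 2 - 1) + 1 / 2 + γ) = ((n : ℝ) / 2 - 1) + 1 / 2 + γ by ring,
      show -(((n : ℝ) - 1) / 2 + (-((n : ℝ) / 2 - 1) + 1 / 2 + γ)) = -1 + -γ by ring,
      Real.rpow_add hy, Real.rpow_add hy, Real.rpow_add hz, Real.rpow_add hz, Real.rpow_add hs,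
      Real.rpow_neg hy.le, Real.rpow_neg hs.le, Real.rpow_neg hs.le, Real.rpow_one]
    ring
  have hE : Real.exp (((n : ℝ) - 1) * s / 4) ≤ Real.exp (((n : ℝ) - 1) / 4) :=
    Real.exp_le_exp.mpr (by nlinarith)
  have hdamp : (1 + w) ^ (-(γ + 1 / 2))
      ≤ (1 + Real.exp (-1 / 2) / 2 * (y * z / s)) ^ (-((n : ℝ) / 2 - 1 + α)) := by
    rw [show (n : ℝ) / 2 - 1 + α = γ + 1 / 2 by linarith]
    exact Real.rpow_le_rpow_of_nonpos (by positivity) (by linarith) (by linarith)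
  set Q : ℝ := (1 + Real.exp (-1 / 2) / 2 * (y * z / s)) ^ (-((n : ℝ) / 2 - 1 + α))
  calc (z / y) ^ ((n : ℝ) / 2 - 1) * Real.sqrt (y * z)
        * (Real.exp (((n : ℝ) - 1) * s / 4) / (2 * A)) * Iγ w
        * Real.exp (-(Real.exp (-s) * y ^ 2 + z ^ 2) / (4 * A))
      ≤ (z / y) ^ ((n : ℝ) / 2 - 1) * Real.sqrt (y * z)
        * (Real.exp (((n : ℝ) - 1) * s / 4) / (2 * A))
        * (C * (w / 2) ^ γ * (1 + w) ^ (-(γ + 1 / 2)) * Real.exp w)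
        * Real.exp (-(Real.exp (-s) * y ^ 2 + z ^ 2) / (4 * A)) := by gcongr
    _ = (z / y) ^ ((n : ℝ) / 2 - 1) * Real.sqrt (y * z)
        * (Real.exp (((n : ℝ) - 1) * s / 4) * (1 / A) / 2)
        * (C * (w / 2) ^ γ * (1 + w) ^ (-(γ + 1 / 2)))
        * (Real.exp w * Real.exp (-(Real.exp (-s) * y ^ 2 + z ^ 2) / (4 * A))) := by
        ring_nf
    _ ≤ (z / y) ^ ((n : ℝ) / 2 - 1) * Real.sqrt (y * z)
        * (Real.exp (((n : ℝ) - 1) / 4) * (Real.exp 1 / s) / 2)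
        * (C * (Real.exp 1 * (y * z / s)) ^ γ * Q)
        * Real.exp (-(Real.exp (-s / 2) * y - z) ^ 2 / (4 * s)) := by
        gcongr
    _ = Real.exp (((n : ℝ) - 1) / 4) * (Real.exp 1 / 2) * Real.exp 1 ^ γ * C
        * ((z / y) ^ ((n : ℝ) / 2 - 1) * Real.sqrt (y * z) * (1 / s) * (y * z / s) ^ γ) * Q
        * Real.exp (-(Real.exp (-s / 2) * y - z) ^ 2 / (4 * s)) := by
        rw [Real.mul_rpow (Real.exp_pos 1).le (by positivity)]
        ring
    _ = _ := by rw [hpow]; ring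
end
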